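/- Let π_LOC be any output of the greedy concatenation algorithm. Then there exists an optimal checking sequence π* with λ(π_LOC) ≤ λ(π*); moreover, every optimal checking sequence π* satisfies λ(π*) ≤ λ(Π(i_max)). -/

import Mathlib

noncomputable section

/-- Parameters of the cost-asymmetric memory-hard password hashing model:
`n` passwords with probabilities `p 1 >= ... >= p n`, `m` breakpoints with
probabilities `q 1, ..., q m`, running-time breakpoints `t 0 < t 1 < ... < t m`,
memory-cost constant `cM` and password value `v`. -/
structure Params where
  n : ℕ
  m : ℕ
  p : ℕ → ℝ
  q : ℕ → ℝ
  t : ℕ → ℝ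
  cM : ℝ
  v : ℝ

namespace Params

/-- The standing hypotheses on the parameters. -/
structure Hyp (P : Params) : Prop where
  hn : 1 ≤ P.n
  hm : 1 ≤ P.m
  p_pos : ∀ i ∈ Finset.Icc 1 P.n, 0 < P.p i
  p_anti : ∀ i ∈ Finset.Icc 1 P.n, ∀ i' ∈ Finset.Icc 1 P.n, i ≤ i' → P.p i' ≤ P.p i
  p_sum : ∑ i ∈ Finset.Icc 1 P.n, P.p i ≤ 1
  q_nonneg : ∀ j ∈ Finset.Icc 1 P.m, 0 ≤ P.q j
  q_sum : ∑ j ∈ Finset.Icc 1 P.m, P.q j = 1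
  t_zero : P.t 0 = 0
  t_mono : ∀ j j', j < j' → j' ≤ P.m → P.t j < P.t j'
  cM_pos : 0 < P.cM
  v_pos : 0 < P.v

/-- Cumulative breakpoint probability `Q j = q 1 + ... + q j`. -/
def Q (P : Params) (j : ℕ) : ℝ := ∑ j' ∈ Finset.Icc 1 j, P.q j'

/-- Round cost `c(i, j) = cM * (t j ^ 2 - t (j-1) ^ 2)` of executing an
instruction with label index `j` (it does not depend on the password index). -/
def rc (P : Params) (j : ℕ) : ℝ := P.cM * (P.t j ^ 2 - P.t (j - 1) ^ 2)

/-- A checking sequence is determined by its exponent vector `τ`: for each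
password `i ∈ [1, n]` the attacker executes the instructions
`(i, 1), ..., (i, τ i)`, passwords being processed in increasing order.
`τ` is valid if `τ i ≤ m` for all `i` and `τ i = 0` outside `[1, n]`. -/
def Valid (P : Params) (τ : ℕ → ℕ) : Prop :=
  (∀ i, τ i ≤ P.m) ∧ ∀ i, i ∉ Finset.Icc 1 P.n → τ i = 0

/-- Success probability `λ(π)` of the checking sequence with exponent vector `τ`. -/
def lam (P : Params) (τ : ℕ → ℕ) : ℝ := ∑ i ∈ Finset.Icc 1 P.n, P.p i * P.Q (τ i)

/-- Probability mass `λ(π, k-1)` of the instructions strictly preceding the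
instruction `(i, j)` in the checking sequence with exponent vector `τ`. -/
def lamBefore (P : Params) (τ : ℕ → ℕ) (i j : ℕ) : ℝ :=
  (∑ i' ∈ Finset.Ico 1 i, P.p i' * P.Q (τ i')) + P.p i * P.Q (j - 1)

/-- Attacker's utility `U(π) = v·λ(π) - Σ_k c(π_k)·(1 - λ(π, k-1))`. -/
def U (P : Params) (τ : ℕ → ℕ) : ℝ :=
  P.v * P.lam τ -
    ∑ i ∈ Finset.Icc 1 P.n, ∑ j ∈ Finset.Icc 1 (τ i), P.rc j * (1 - P.lamBefore τ i j)

/-- A checking sequence is optimal if it maximizes the attacker's utility. -/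
def Optimal (P : Params) (τ : ℕ → ℕ) : Prop :=
  P.Valid τ ∧ ∀ τ', P.Valid τ' → P.U τ' ≤ P.U τ

/-- `π ⊆ π'` for checking sequences: `τ i ≤ τ' i` for all `i`. -/
def Subseq (P : Params) (τ τ' : ℕ → ℕ) : Prop := ∀ i, τ i ≤ τ' i

/-- `Π(l)`: the checking sequence fully checking the top `l` passwords
(`τ i = m` for `i ≤ l` and `τ i = 0` for `i > l`). -/
def Pifull (P : Params) (l : ℕ) : ℕ → ℕ := fun i => if 1 ≤ i ∧ i ≤ l then P.m else 0

/-- `F i`: the best marginal utility of appending a block `ϖ_i(1, j)`,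
`1 ≤ j ≤ m`, to `Π(i - 1)`. -/
def F (P : Params) (i : ℕ) : ℝ :=
  sSup ((fun j => P.U (Function.update (P.Pifull (i - 1)) i j) - P.U (P.Pifull (i - 1))) ''
    Set.Icc 1 P.m)

/-- `i_max`: the largest `i ∈ [1, n]` with `F i ≥ 0`, or `0` if there is none. -/
def imax (P : Params) : ℕ := sSup {i | i ∈ Finset.Icc 1 P.n ∧ 0 ≤ P.F i}

/-- Truncation of an exponent vector to the first `k` passwords. -/
def truncSeq (τ : ℕ → ℕ) (k : ℕ) : ℕ → ℕ := fun i => if i ≤ k then τ i else 0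

/-- `τ` is a possible output of the greedy concatenation algorithm: for
`i = 1, 2, ...` the algorithm appends a block `ϖ_i(1, τ i)` with `τ i ∈ [0, m]`
maximizing the marginal utility upon concatenation, stopping the first time the
chosen exponent is `0`. -/
def GreedyOutput (P : Params) (τ : ℕ → ℕ) : Prop :=
  P.Valid τ ∧
    ∃ l ≤ P.n,
      (∀ i, 1 ≤ i → i ≤ l → 1 ≤ τ i) ∧
      (∀ i, l < i → τ i = 0) ∧
      (∀ i, 1 ≤ i → i ≤ l → ∀ j ≤ P.m,
        P.U (Function.update (truncSeq τ (i - 1)) i j) ≤ P.U (truncSeq τ i)) ∧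
      (l < P.n → ∀ j, 1 ≤ j → j ≤ P.m → P.U (Function.update τ (l + 1) j) ≤ P.U τ)

/-- Total round cost of the block `ϖ_i(1, j)`. -/
def cumCost (P : Params) (j : ℕ) : ℝ := ∑ j' ∈ Finset.Icc 1 j, P.rc j'

/-- Success probability contributed by the first `i - 1` passwords. -/
def lamPrefix (P : Params) (τ : ℕ → ℕ) (i : ℕ) : ℝ :=
  ∑ i' ∈ Finset.Ico 1 i, P.p i' * P.Q (τ i')

/-- Marginal utility of appending the block `ϖ_i(1, j)` to a checking sequence on the first
`i - 1` passwords with success probability `S`. -/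
def blockGain (P : Params) (i j : ℕ) (S : ℝ) : ℝ :=
  P.p i * (P.v * P.Q j + ∑ j' ∈ Finset.Icc 1 j, P.rc j' * P.Q (j' - 1)) - P.cumCost j * (1 - S)

/-- Total round cost of the blocks for passwords after `k`. -/
def costAfter (P : Params) (τ : ℕ → ℕ) (k : ℕ) : ℝ :=
  ∑ i ∈ Finset.Icc 1 P.n, if k < i then P.cumCost (τ i) else 0

section

variable {P : Params}

theorem Q_zero : P.Q 0 = 0 := by simp [Q]

theorem cumCost_zero : P.cumCost 0 = 0 := by simp [cumCost]

theorem blockGain_zero (i : ℕ) (S : ℝ) : P.blockGain i 0 S = 0 := by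
  simp [blockGain, Q_zero, cumCost_zero]

theorem blockGain_add (i j : ℕ) (S d : ℝ) :
    P.blockGain i j (S + d) = P.blockGain i j S + P.cumCost j * d := by
  unfold blockGain
  ring

theorem U_eq_sum_blockGain (τ : ℕ → ℕ) :
    P.U τ = ∑ i ∈ Finset.Icc 1 P.n, P.blockGain i (τ i) (P.lamPrefix τ i) := by
  unfold U lam
  rw [Finset.mul_sum, ← Finset.sum_sub_distrib]
  refine Finset.sum_congr rfl fun i _ => ?_
  have h : ∑ j ∈ Finset.Icc 1 (τ i), P.rc j * (1 - P.lamBefore τ i j) =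
      P.cumCost (τ i) * (1 - P.lamPrefix τ i) -
        P.p i * ∑ j ∈ Finset.Icc 1 (τ i), P.rc j * P.Q (j - 1) := by
    unfold cumCost
    rw [Finset.sum_mul, Finset.mul_sum, ← Finset.sum_sub_distrib]
    refine Finset.sum_congr rfl fun j _ => ?_
    unfold lamBefore lamPrefix
    ring
  rw [h, blockGain]
  ring

theorem lamPrefix_update (τ : ℕ → ℕ) {k : ℕ} (hk : 1 ≤ k) (j i : ℕ) :
    P.lamPrefix (Function.update τ k j) i =
      P.lamPrefix τ i + if k < i then P.p k * (P.Q j - P.Q (τ k)) else 0 := by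
  have h : ∀ i' ∈ Finset.Ico 1 i, P.p i' * P.Q (Function.update τ k j i') =
      P.p i' * P.Q (τ i') + if i' = k then P.p k * (P.Q j - P.Q (τ k)) else 0 := by
    intro i' _
    by_cases h : i' = k
    · subst h
      simp only [Function.update_self, if_true]
      ring
    · simp [h]
  unfold lamPrefix
  rw [Finset.sum_congr rfl h, Finset.sum_add_distrib, Finset.sum_ite_eq']
  simp [hk]

theorem U_update (τ : ℕ → ℕ) {k : ℕ} (hk : k ∈ Finset.Icc 1 P.n) (j : ℕ) :
    P.U (Function.update τ k j) = P.U τ +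
      (P.blockGain k j (P.lamPrefix τ k) - P.blockGain k (τ k) (P.lamPrefix τ k)) +
      P.p k * (P.Q j - P.Q (τ k)) * P.costAfter τ k := by
  have hk1 := (Finset.mem_Icc.mp hk).1
  have h : ∀ i ∈ Finset.Icc 1 P.n,
      P.blockGain i (Function.update τ k j i) (P.lamPrefix (Function.update τ k j) i) =
        P.blockGain i (τ i) (P.lamPrefix τ i) +
        (if i = k then
          P.blockGain k j (P.lamPrefix τ k) - P.blockGain k (τ k) (P.lamPrefix τ k) else 0) +
        P.p k * (P.Q j - P.Q (τ k)) * (if k < i then P.cumCost (τ i) else 0) := by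
    intro i _
    rw [lamPrefix_update τ hk1]
    by_cases h : i = k
    · subst h
      simp
    · by_cases h' : k < i
      · simp only [h, h', if_true, if_false, Function.update_of_ne h, blockGain_add]
        ring
      · simp [h, h']
  rw [U_eq_sum_blockGain, U_eq_sum_blockGain, Finset.sum_congr rfl h, Finset.sum_add_distrib,
    Finset.sum_add_distrib, Finset.sum_ite_eq', if_pos hk, ← Finset.mul_sum, costAfter]

theorem costAfter_eq_zero {τ : ℕ → ℕ} {k : ℕ} (h : ∀ i ∈ Finset.Icc 1 P.n, k < i → τ i = 0) :
    P.costAfter τ k = 0 := by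
  refine Finset.sum_eq_zero fun i hi => ?_
  split_ifs with hki
  · rw [h i hi hki, cumCost_zero]
  · rfl

theorem Q_mono (hP : P.Hyp) {j j' : ℕ} (h : j ≤ j') (h' : j' ≤ P.m) : P.Q j ≤ P.Q j' := by
  refine Finset.sum_le_sum_of_subset_of_nonneg (Finset.Icc_subset_Icc_right h) fun i hi _ => ?_
  exact hP.q_nonneg i (Finset.Icc_subset_Icc_right h' hi)

theorem rc_nonneg (hP : P.Hyp) {j : ℕ} (hj : j ∈ Finset.Icc 1 P.m) : 0 ≤ P.rc j := by
  rw [Finset.mem_Icc] at hj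
  have h0 : 0 ≤ P.t (j - 1) := by
    rcases Nat.eq_zero_or_pos (j - 1) with h | h
    · rw [h, hP.t_zero]
    · rw [← hP.t_zero]
      exact (hP.t_mono 0 (j - 1) h (by omega)).le
  have h1 := hP.t_mono (j - 1) j (by omega) hj.2
  exact mul_nonneg hP.cM_pos.le (sub_nonneg.mpr (pow_le_pow_left₀ h0 h1.le 2))

theorem cumCost_mono (hP : P.Hyp) {j j' : ℕ} (h : j ≤ j') (h' : j' ≤ P.m) :
    P.cumCost j ≤ P.cumCost j' :=
  Finset.sum_le_sum_of_subset_of_nonneg (Finset.Icc_subset_Icc_right h) fun _ hi _ =>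
    rc_nonneg hP (Finset.Icc_subset_Icc_right h' hi)

theorem cumCost_nonneg (hP : P.Hyp) {j : ℕ} (h : j ≤ P.m) : 0 ≤ P.cumCost j :=
  cumCost_zero.symm.trans_le (cumCost_mono hP j.zero_le h)

theorem costAfter_nonneg (hP : P.Hyp) {τ : ℕ → ℕ} (hτ : P.Valid τ) (k : ℕ) :
    0 ≤ P.costAfter τ k := by
  refine Finset.sum_nonneg fun i _ => ?_
  split_ifs
  · exact cumCost_nonneg hP (hτ.1 i)
  · exact le_rfl

theorem lamPrefix_mono (hP : P.Hyp) {τ τ' : ℕ → ℕ} {k : ℕ} (hk : k ≤ P.n)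
    (h : ∀ i ∈ Finset.Ico 1 k, τ i ≤ τ' i) (h' : ∀ i ∈ Finset.Ico 1 k, τ' i ≤ P.m) :
    P.lamPrefix τ k ≤ P.lamPrefix τ' k := by
  refine Finset.sum_le_sum fun i hi => ?_
  have hi' : i ∈ Finset.Icc 1 P.n := by
    rw [Finset.mem_Ico] at hi
    exact Finset.mem_Icc.mpr ⟨hi.1, by omega⟩
  exact mul_le_mul_of_nonneg_left (Q_mono hP (h i hi) (h' i hi)) (hP.p_pos i hi').le

/-- Increasing differences of the block gain in the exponent and the prior success probability. -/
theorem blockGain_sub_mono (hP : P.Hyp) (i : ℕ) {j j' : ℕ} (h : j ≤ j') (h' : j' ≤ P.m)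
    {S S' : ℝ} (hS : S ≤ S') :
    P.blockGain i j' S - P.blockGain i j S ≤ P.blockGain i j' S' - P.blockGain i j S' := by
  obtain ⟨d, hd, rfl⟩ : ∃ d, 0 ≤ d ∧ S' = S + d := ⟨S' - S, by linarith, by ring⟩
  rw [blockGain_add, blockGain_add]
  nlinarith [mul_le_mul_of_nonneg_right (cumCost_mono hP h h') hd]

theorem exists_optimal (P : Params) : ∃ τ, P.Optimal τ := by
  let e : (Finset.Icc 1 P.n → Fin (P.m + 1)) → ℕ → ℕ := fun f i =>
    if h : i ∈ Finset.Icc 1 P.n then f ⟨i, h⟩ else 0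
  obtain ⟨f, hf⟩ := Finite.exists_max fun f => P.U (e f)
  refine ⟨e f, ⟨fun i => ?_, fun i hi => dif_neg hi⟩, fun τ hτ => ?_⟩
  · by_cases h : i ∈ Finset.Icc 1 P.n
    · simpa only [e, dif_pos h] using Nat.lt_succ_iff.mp (f ⟨i, h⟩).isLt
    · simp only [e, dif_neg h, Nat.zero_le]
  · have h : e (fun i => ⟨τ i, Nat.lt_succ_iff.mpr (hτ.1 i)⟩) = τ := by
      funext i
      by_cases h : i ∈ Finset.Icc 1 P.n
      · simp only [e, dif_pos h]
      · simp only [e, dif_neg h, hτ.2 i h]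
    have := hf fun i => ⟨τ i, Nat.lt_succ_iff.mpr (hτ.1 i)⟩
    rwa [h] at this

theorem update_truncSeq {τ : ℕ → ℕ} {i : ℕ} (hi : 1 ≤ i) :
    Function.update (truncSeq τ (i - 1)) i (τ i) = truncSeq τ i := by
  funext k
  by_cases h : k = i
  · subst h
    simp [truncSeq]
  · have : k ≤ i - 1 ↔ k ≤ i := by omega
    simp [truncSeq, h, this]

theorem GreedyOutput.blockGain_le {τ : ℕ → ℕ} (h : P.GreedyOutput τ) {i : ℕ}
    (hi : i ∈ Finset.Icc 1 P.n) (hτi : τ i ≠ 0) {j : ℕ} (hj : j ≤ P.m) :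
    P.blockGain i j (P.lamPrefix τ i) ≤ P.blockGain i (τ i) (P.lamPrefix τ i) := by
  obtain ⟨_, l, _, _, h0, hopt, _⟩ := h
  have hi1 := (Finset.mem_Icc.mp hi).1
  have hil : i ≤ l := by
    by_contra hlt
    exact hτi (h0 i (by omega))
  have hle := hopt i hi1 hil j hj
  have hpre : P.lamPrefix (truncSeq τ (i - 1)) i = P.lamPrefix τ i := by
    refine Finset.sum_congr rfl fun k hk => ?_
    rw [Finset.mem_Ico] at hk
    rw [truncSeq, if_pos (by omega)]
  have hcost : P.costAfter (truncSeq τ (i - 1)) i = 0 :=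
    costAfter_eq_zero fun k _ hk => if_neg (by omega)
  rw [← update_truncSeq hi1, U_update _ hi, U_update _ hi, hcost, hpre] at hle
  linarith

theorem exists_optimal_ge_of_greedyOutput (hP : P.Hyp) {τ : ℕ → ℕ} (hgr : P.GreedyOutput τ) :
    ∃ τs, P.Optimal τs ∧ ∀ i, τ i ≤ τs i := by
  obtain ⟨σ, hσ⟩ := exists_optimal P
  have key : ∀ k ≤ P.n, P.Optimal fun i => if i ≤ k then max (τ i) (σ i) else σ i := by
    intro k
    induction k with
    | zero =>
      intro _
      convert hσ using 2 with i
      by_cases h : i = 0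
      · subst h
        simp [hgr.1.2 0 (by simp)]
      · simp [h]
    | succ k ih =>
      intro hk
      have hopt := ih (by omega)
      set ρ : ℕ → ℕ := fun i => if i ≤ k then max (τ i) (σ i) else σ i with hρ
      have hmem : k + 1 ∈ Finset.Icc 1 P.n := Finset.mem_Icc.mpr ⟨by omega, hk⟩
      have hρk : ρ (k + 1) = σ (k + 1) := if_neg (by omega)
      have heq : (fun i => if i ≤ k + 1 then max (τ i) (σ i) else σ i) =
          Function.update ρ (k + 1) (max (τ (k + 1)) (σ (k + 1))) := by
        funext i
        by_cases h : i = k + 1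
        · subst h
          simp
        · have : i ≤ k + 1 ↔ i ≤ k := by omega
          simp [h, hρ, this]
      rw [heq]
      rcases le_or_gt (τ (k + 1)) (σ (k + 1)) with hle | hlt
      · rwa [max_eq_right hle, ← hρk, Function.update_eq_self]
      · rw [max_eq_left hlt.le]
        have hτm := hgr.1.1 (k + 1)
        have hS : P.lamPrefix τ (k + 1) ≤ P.lamPrefix ρ (k + 1) := by
          refine lamPrefix_mono hP hk (fun i hi => ?_) fun i _ => hopt.1.1 i
          rw [Finset.mem_Ico] at hi
          rw [hρ]
          dsimp only
          rw [if_pos (by omega)]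
          exact le_max_left _ _
        have h1 := blockGain_sub_mono hP (k + 1) hlt.le hτm hS
        have h2 := hgr.blockGain_le hmem (by omega) (hσ.1.1 (k + 1))
        have h3 : 0 ≤ P.p (k + 1) * (P.Q (τ (k + 1)) - P.Q (σ (k + 1))) * P.costAfter ρ (k + 1) :=
          mul_nonneg (mul_nonneg (hP.p_pos _ hmem).le (sub_nonneg.mpr (Q_mono hP hlt.le hτm)))
            (costAfter_nonneg hP hopt.1 _)
        refine ⟨⟨fun i => ?_, fun i hi => ?_⟩, fun τ' hτ' => (hopt.2 τ' hτ').trans ?_⟩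
        · by_cases h : i = k + 1
          · subst h
            simpa using hτm
          · simpa [h] using hopt.1.1 i
        · have h : i ≠ k + 1 := fun h => hi (h ▸ hmem)
          simpa [h] using hopt.1.2 i hi
        · rw [U_update _ hmem, hρk]
          linarith
  refine ⟨_, key P.n le_rfl, fun i => ?_⟩
  split_ifs with h
  · exact le_max_left _ _
  · rw [hgr.1.2 i (by simp; omega)]
    exact Nat.zero_le _

theorem blockGain_lt_zero_of_imax_lt {i : ℕ} (hi : i ∈ Finset.Icc 1 P.n) (hlt : P.imax < i)
    {j : ℕ} (hj : j ∈ Set.Icc 1 P.m) :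
    P.blockGain i j (P.lamPrefix (P.Pifull (i - 1)) i) < 0 := by
  have hF : P.F i < 0 := by
    by_contra h
    have hbdd : BddAbove {i | i ∈ Finset.Icc 1 P.n ∧ 0 ≤ P.F i} :=
      ⟨P.n, fun k hk => (Finset.mem_Icc.mp hk.1).2⟩
    exact absurd (le_csSup hbdd ⟨hi, not_lt.mp h⟩) (not_le.mpr hlt)
  have hle := (le_csSup ((Set.finite_Icc 1 P.m).image _).bddAbove
    (Set.mem_image_of_mem (fun j => P.U (Function.update (P.Pifull (i - 1)) i j) -
      P.U (P.Pifull (i - 1))) hj)).trans_lt hF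
  have hi1 := (Finset.mem_Icc.mp hi).1
  have h0 : P.Pifull (i - 1) i = 0 := if_neg (by omega)
  have hcost : P.costAfter (P.Pifull (i - 1)) i = 0 :=
    costAfter_eq_zero fun k _ hk => if_neg (by omega)
  rw [U_update _ hi, h0, hcost, blockGain_zero] at hle
  linarith

theorem Optimal.eq_zero_of_imax_lt (hP : P.Hyp) {τ : ℕ → ℕ} (hτ : P.Optimal τ) {i : ℕ}
    (hi : P.imax < i) : τ i = 0 := by
  by_contra hne
  have hsupp : ∀ k, τ k ≠ 0 → k ∈ Finset.Icc 1 P.n := fun k hk => by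
    by_contra h
    exact hk (hτ.1.2 k h)
  obtain ⟨k, hk, hmax⟩ := ((Finset.Icc 1 P.n).filter (τ · ≠ 0)).exists_max_image id
    ⟨i, Finset.mem_filter.mpr ⟨hsupp i hne, hne⟩⟩
  obtain ⟨hkmem, hk0⟩ := Finset.mem_filter.mp hk
  have hik : i ≤ k := hmax i (Finset.mem_filter.mpr ⟨hsupp i hne, hne⟩)
  have hcost : P.costAfter τ k = 0 := by
    refine costAfter_eq_zero fun k' hk' hlt => ?_
    by_contra h
    exact absurd (hmax k' (Finset.mem_filter.mpr ⟨hk', h⟩)) (not_le.mpr hlt)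
  have hneg := blockGain_lt_zero_of_imax_lt hkmem (hi.trans_le hik)
    (j := τ k) ⟨Nat.one_le_iff_ne_zero.mpr hk0, hτ.1.1 k⟩
  have hfull : ∀ i' ∈ Finset.Ico 1 k, P.Pifull (k - 1) i' = P.m := fun i' hi' => by
    rw [Finset.mem_Ico] at hi'
    exact if_pos (by omega)
  have hS : P.lamPrefix τ k ≤ P.lamPrefix (P.Pifull (k - 1)) k :=
    lamPrefix_mono hP (Finset.mem_Icc.mp hkmem).2
      (fun i' hi' => (hτ.1.1 i').trans_eq (hfull i' hi').symm) fun i' hi' => (hfull i' hi').le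
  have hle := blockGain_sub_mono hP k (Nat.zero_le (τ k)) (hτ.1.1 k) hS
  have hvalid : P.Valid (Function.update τ k 0) := by
    refine ⟨fun i' => ?_, fun i' hi' => ?_⟩ <;> by_cases h : i' = k
    · simp [h]
    · simpa [h] using hτ.1.1 i'
    · simp [h]
    · simpa [h] using hτ.1.2 i' hi'
  have hU := hτ.2 _ hvalid
  rw [U_update _ hkmem, hcost, blockGain_zero] at hU
  rw [blockGain_zero, blockGain_zero] at hle
  linarith

theorem lam_mono (hP : P.Hyp) {τ τ' : ℕ → ℕ} (h : ∀ i ∈ Finset.Icc 1 P.n, τ i ≤ τ' i)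
    (h' : ∀ i, τ' i ≤ P.m) : P.lam τ ≤ P.lam τ' :=
  Finset.sum_le_sum fun i hi =>
    mul_le_mul_of_nonneg_left (Q_mono hP (h i hi) (h' i)) (hP.p_pos i hi).le

end

/-- `λ(π_LOC) ≤ λ(π*)` for some optimal `π*`, and every optimal
`π*` satisfies `λ(π*) ≤ λ(Π(i_max))`. -/
theorem statement6 (P : Params) (hP : P.Hyp) (τ : ℕ → ℕ) (hgr : P.GreedyOutput τ) :
    (∃ τs, P.Optimal τs ∧ P.lam τ ≤ P.lam τs) ∧
      ∀ τs, P.Optimal τs → P.lam τs ≤ P.lam (P.Pifull P.imax) := by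
  refine ⟨?_, fun τs hτs => ?_⟩
  · obtain ⟨τs, hopt, hle⟩ := exists_optimal_ge_of_greedyOutput hP hgr
    exact ⟨τs, hopt, lam_mono hP (fun i _ => hle i) hopt.1.1⟩
  · refine lam_mono hP (fun i hi => ?_) fun i => ?_
    · by_cases h : i ≤ P.imax
      · rw [Pifull, if_pos ⟨(Finset.mem_Icc.mp hi).1, h⟩]
        exact hτs.1.1 i
      · rw [hτs.eq_zero_of_imax_lt hP (not_le.mp h)]
        exact Nat.zero_le _
    · unfold Pifull
      split_ifs <;> simp

end Params
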